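/- Position monotonicity: fix all bids except that of bidder x (with p_x > 0). If b < b' are two bids, S = F ++ [x] ++ G is optimal at bid b, and T = A ++ [x] ++ E is optimal at bid b' with strictly greater click probability for x (q(A) < q(F) is false, i.e., q(A) > q(F) — x is looked at with higher probability in T), and all adjusted ecpms are distinct at the common tie bid, then |A| ≤ |F| leads to no contradiction while |A| > |F| with both S and T optimal at a common bid b* is impossible; hence the position of x (number of ads above x) in the optimal solution is non-increasing as b_x increases. -/

import Mathlib

noncomputable section

/-- Efficiency of an ordered list of ads `(e, q)`. -/
def eff : List (ℝ × ℝ) → ℝ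
  | [] => 0
  | a :: L => a.1 + a.2 * eff L

/-- Product of continuation probabilities of a list of ads. -/
def qprod (L : List (ℝ × ℝ)) : ℝ := (L.map Prod.snd).prod

/-- Adjusted ecpm `e / (1 - q)` of an ad. -/
def adjEcpm (a : ℝ × ℝ) : ℝ := a.1 / (1 - a.2)

lemma fst_eq_adjEcpm_mul {a : ℝ × ℝ} (h : a.2 < 1) : a.1 = adjEcpm a * (1 - a.2) := by
  have : (1 - a.2) ≠ 0 := by linarith
  unfold adjEcpm
  field_simp

lemma eff_append (L M : List (ℝ × ℝ)) : eff (L ++ M) = eff L + qprod L * eff M := by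
  induction L with
  | nil => simp [eff, qprod]
  | cons a L ih =>
    simp only [List.cons_append, eff, ih, qprod, List.map_cons, List.prod_cons]
    ring

lemma qprod_cons (a : ℝ × ℝ) (L : List (ℝ × ℝ)) : qprod (a :: L) = a.2 * qprod L := by
  simp [qprod]

lemma qprod_pos {L : List (ℝ × ℝ)} (h : ∀ a ∈ L, 0 < a.2) : 0 < qprod L := by
  induction L with
  | nil => simp [qprod]
  | cons a L ih =>
    rw [qprod_cons]
    exact mul_pos (h a (by simp)) (ih fun b hb => h b (by simp [hb]))

lemma eff_nonneg {L : List (ℝ × ℝ)} (h : ∀ a ∈ L, 0 ≤ a.1 ∧ 0 < a.2) : 0 ≤ eff L := by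
  induction L with
  | nil => simp [eff]
  | cons a L ih =>
    have ha := h a (by simp)
    have := ih fun b hb => h b (by simp [hb])
    have := mul_nonneg ha.2.le this
    simp only [eff]
    linarith [ha.1]

lemma eff_le_of_adjEcpm_le {L : List (ℝ × ℝ)} {c : ℝ} (hc : 0 ≤ c)
    (h : ∀ a ∈ L, adjEcpm a ≤ c ∧ 0 < a.2 ∧ a.2 < 1) : eff L ≤ c := by
  induction L with
  | nil => simpa [eff] using hc
  | cons a L ih =>
    obtain ⟨h1, h2, h3⟩ := h a (by simp)
    have h4 := ih fun b hb => h b (by simp [hb])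
    simp only [eff]
    rw [fst_eq_adjEcpm_mul h3]
    nlinarith

/-- A duplicate-free list over `D` of length at most `k ≤ #D` extends to one of length `k`. -/
lemma exists_nodup_append_length_eq {β : Type*} [DecidableEq β] (D : Finset β) {k : ℕ}
    (hk : k ≤ D.card) {L : List β} (hL : L.Nodup) (hLD : ∀ a ∈ L, a ∈ D) (hlen : L.length ≤ k) :
    ∃ M : List β, (L ++ M).Nodup ∧ (∀ a ∈ M, a ∈ D) ∧ (L ++ M).length = k := by
  have hsub : L.toFinset ⊆ D := fun a ha => hLD a (by simpa using ha)
  have hcard : (D \ L.toFinset).card = D.card - L.length := by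
    rw [Finset.card_sdiff_of_subset hsub, List.toFinset_card_of_nodup hL]
  obtain ⟨M, hM, hMc⟩ := Finset.exists_subset_card_eq (s := D \ L.toFinset)
    (n := k - L.length) (by omega)
  refine ⟨M.toList, ?_, ?_, ?_⟩
  · refine List.Nodup.append hL (Finset.nodup_toList M) ?_
    intro a ha haM
    have := hM (Finset.mem_toList.1 haM)
    simp only [Finset.mem_sdiff, List.mem_toFinset] at this
    exact this.2 ha
  · intro a ha
    exact (Finset.mem_sdiff.1 (hM (Finset.mem_toList.1 ha))).1
  · simp only [List.length_append, Finset.length_toList, hMc]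
    omega

/-- A list maximizing the efficiency among its permutations is strictly sorted by decreasing
adjusted ecpm, provided these are pairwise distinct. -/
lemma pairwise_adjEcpm_of_optimal {L : List (ℝ × ℝ)} (hL : L.Nodup)
    (hq : ∀ a ∈ L, 0 < a.2 ∧ a.2 < 1)
    (hinj : ∀ a ∈ L, ∀ b ∈ L, adjEcpm a = adjEcpm b → a = b)
    (hopt : ∀ M : List (ℝ × ℝ), M.Perm L → eff M ≤ eff L) :
    L.Pairwise fun a b => adjEcpm b < adjEcpm a := by
  have : IsTrans (ℝ × ℝ) fun a b => adjEcpm b < adjEcpm a := ⟨fun _ _ _ h h' => h'.trans h⟩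
  rw [← List.isChain_iff_pairwise]
  rw [List.isChain_iff_forall_rel_of_append_cons_cons]
  rintro a b l₁ l₂ rfl
  have ha := hq a (by simp)
  have hb := hq b (by simp)
  have hne : a ≠ b := by
    rintro rfl
    simp [List.nodup_append] at hL
  have hswap := hopt (l₁ ++ b :: a :: l₂) ((List.Perm.swap a b l₂).append_left l₁)
  have hl₁ : 0 < qprod l₁ := qprod_pos fun c hc => (hq c (by simp [hc])).1
  refine lt_of_le_of_ne ?_ fun h => hne (hinj b (by simp) a (by simp) h).symm
  simp only [eff_append, eff] at hswap
  have h := le_of_mul_le_mul_left (le_of_add_le_add_left hswap) hl₁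
  unfold adjEcpm
  rw [div_le_div_iff₀ (by linarith) (by linarith)]
  linarith

/-- Largest value of `eff X + qprod X * V` over the sublists `X` of `L` of length at most `m`. -/
def optVal : List (ℝ × ℝ) → ℕ → ℝ → ℝ
  | [], _, V => V
  | _ :: _, 0, V => V
  | a :: L, m + 1, V => max (optVal L (m + 1) V) (a.1 + a.2 * optVal L m V)

lemma optVal_zero (L : List (ℝ × ℝ)) (V : ℝ) : optVal L 0 V = V := by
  cases L <;> simp [optVal]

lemma exists_sublist_optVal_eq (L : List (ℝ × ℝ)) (m : ℕ) (V : ℝ) :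
    ∃ X : List (ℝ × ℝ), X.Sublist L ∧ X.length ≤ m ∧ optVal L m V = eff X + qprod X * V := by
  induction L generalizing m with
  | nil => exact ⟨[], by simp, by simp, by simp [optVal, eff, qprod]⟩
  | cons a L ih =>
    cases m with
    | zero => exact ⟨[], by simp, by simp, by simp [optVal, eff, qprod]⟩
    | succ m =>
      rcases max_choice (optVal L (m + 1) V) (a.1 + a.2 * optVal L m V) with h | h
      · obtain ⟨X, hX, hm, h'⟩ := ih (m + 1)
        exact ⟨X, hX.cons a, hm, by rw [optVal, h, h']⟩
      · obtain ⟨X, hX, hm, h'⟩ := ih m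
        refine ⟨a :: X, hX.cons_cons a, by simpa using hm, ?_⟩
        rw [optVal, h, h', eff, qprod_cons]
        ring

lemma le_optVal {L X : List (ℝ × ℝ)} (hX : X.Sublist L) (hq : ∀ a ∈ L, 0 < a.2) {m : ℕ}
    (hm : X.length ≤ m) (V : ℝ) : eff X + qprod X * V ≤ optVal L m V := by
  induction hX generalizing m with
  | slnil => simp [optVal, eff, qprod]
  | cons a hX ih =>
    have h := @ih (fun b hb => hq b (by simp [hb]))
    cases m with
    | zero => simpa [optVal_zero] using h hm
    | succ m => exact (h hm).trans (le_max_left _ _)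
  | cons_cons a hX ih =>
    cases m with
    | zero => simp at hm
    | succ m =>
      have h := @ih (fun b hb => hq b (by simp [hb])) m (by simpa using hm)
      refine le_trans ?_ (le_max_right _ _)
      rw [eff, qprod_cons]
      nlinarith [hq a (by simp)]

lemma optVal_le_optVal_succ {L : List (ℝ × ℝ)} (hq : ∀ a ∈ L, 0 < a.2) (m : ℕ) (V : ℝ) :
    optVal L m V ≤ optVal L (m + 1) V := by
  obtain ⟨X, hX, hm, h⟩ := exists_sublist_optVal_eq L m V
  rw [h]
  exact le_optVal hX hq (by omega) V

lemma optVal_mono {L : List (ℝ × ℝ)} (hq : ∀ a ∈ L, 0 < a.2) {m n : ℕ} (hmn : n ≤ m) {V V' : ℝ}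
    (hV : V ≤ V') : optVal L n V ≤ optVal L m V' := by
  obtain ⟨X, hX, hm, h⟩ := exists_sublist_optVal_eq L n V
  have hX0 : 0 < qprod X := qprod_pos fun a ha => hq a (hX.subset ha)
  rw [h]
  refine le_trans ?_ (le_optVal hX hq (hm.trans hmn) V')
  nlinarith

lemma optVal_lt {L : List (ℝ × ℝ)} {α V : ℝ} (hq : ∀ a ∈ L, 0 < a.2 ∧ a.2 < 1)
    (hα : ∀ a ∈ L, adjEcpm a ≤ α) (hV : V < α) (m : ℕ) : optVal L m V < α := by
  induction L generalizing m with
  | nil => simpa [optVal] using hV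
  | cons a L ih =>
    have ih := ih (fun b hb => hq b (by simp [hb])) (fun b hb => hα b (by simp [hb]))
    cases m with
    | zero => simpa [optVal] using hV
    | succ m =>
      obtain ⟨h1, h2⟩ := hq a (by simp)
      have h3 := hα a (by simp)
      refine max_lt (ih _) ?_
      rw [fst_eq_adjEcpm_mul h2]
      nlinarith [ih m]

/-- If the ratios `f (n + 1) / f n` lie below the later ratios `g (m + 1) / g m`, and `g` lies
below `f`, then the decrements of `g` lie below the earlier decrements of `f`. -/
lemma sub_le_sub_of_mul_le_mul {f₀ f₁ g₀ g₁ : ℝ} (hf : 0 < f₀) (hf₁ : f₁ ≤ f₀) (hg : g₀ ≤ f₀)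
    (h : g₀ * f₁ ≤ g₁ * f₀) : g₀ - g₁ ≤ f₀ - f₁ := by
  refine le_of_mul_le_mul_right ?_ hf
  nlinarith

/-- The map `f ↦ F` with `F 0 = f 0` and `F (i + 1) = min (f (i + 1)) (q * f i)` preserves the
property that the ratios of consecutive terms of `f` lie below the later ones of `g`. -/
lemma mul_succ_le_succ_mul_of_min {f g F G : ℕ → ℝ} {q : ℝ} (hq : 0 < q) (hf : ∀ i, 0 < f i)
    (hg : ∀ i, 0 < g i) (h : ∀ {m n : ℕ}, n ≤ m → g m * f (n + 1) ≤ g (m + 1) * f n)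
    (hF0 : F 0 = f 0) (hG0 : G 0 = g 0) (hF : ∀ i, F (i + 1) = min (f (i + 1)) (q * f i))
    (hG : ∀ i, G (i + 1) = min (g (i + 1)) (q * g i)) {m n : ℕ} (hnm : n ≤ m) :
    G m * F (n + 1) ≤ G (m + 1) * F n := by
  have hF1 : ∀ i, F (i + 1) ≤ f (i + 1) := fun i => (hF i).trans_le (min_le_left _ _)
  have hF2 : ∀ i, F (i + 1) ≤ q * f i := fun i => (hF i).trans_le (min_le_right _ _)
  have hG2 : ∀ i, G (i + 1) ≤ q * g i := fun i => (hG i).trans_le (min_le_right _ _)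
  have hG1 : ∀ i, G i ≤ g i := fun i => by
    cases i with
    | zero => exact hG0.le
    | succ i => exact (hG i).trans_le (min_le_left _ _)
  have hFpos : 0 < F (n + 1) := by
    rw [hF]
    exact lt_min (hf _) (mul_pos hq (hf _))
  have bound : ∀ {u v : ℝ}, G m ≤ u → F (n + 1) ≤ v → 0 < u → G m * F (n + 1) ≤ u * v :=
    fun h1 h2 h3 => mul_le_mul h1 h2 hFpos.le h3.le
  have hqf : 0 < q * f n := mul_pos hq (hf n)
  have b1 := bound (hG1 m) (hF1 n) (hg m)
  have b2 := bound (hG1 m) (hF2 n) (hg m)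
  have h0 := h hnm
  rw [hG m]
  cases n with
  | zero =>
    rw [hF0]
    rcases min_choice (g (m + 1)) (q * g m) with e | e <;> rw [e] <;> linarith
  | succ n =>
    obtain ⟨m, rfl⟩ : ∃ l, m = l + 1 := ⟨m - 1, by omega⟩
    have b3 := bound (hG2 m) (hF2 (n + 1)) (mul_pos hq (hg m))
    have h1 := mul_le_mul_of_nonneg_left (h (show n ≤ m + 1 by omega)) hq.le
    have h2 := mul_le_mul_of_nonneg_left (h (show n ≤ m by omega)) (mul_pos hq hq).le
    rw [hF n]
    rcases min_choice (g (m + 1 + 1)) (q * g (m + 1)) with e | e <;>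
      rcases min_choice (f (n + 1)) (q * f n) with e' | e' <;> rw [e, e'] <;> linarith

/-- The ratio `(α - optVal (m + 1)) / (α - optVal m)` increases with `m` and with the tail. -/
lemma sub_optVal_mul_le {L : List (ℝ × ℝ)} (hq : ∀ a ∈ L, 0 < a.2 ∧ a.2 < 1)
    (hL : L.Pairwise fun a b => adjEcpm b < adjEcpm a) {V V' : ℝ} (hVV : V ≤ V')
    (hV' : ∀ a ∈ L, V' < adjEcpm a) {α : ℝ} (hα : ∀ a ∈ L, adjEcpm a ≤ α) (hαV : V' < α)
    {m n : ℕ} (hnm : n ≤ m) :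
    (α - optVal L m V') * (α - optVal L (n + 1) V) ≤
      (α - optVal L (m + 1) V') * (α - optVal L n V) := by
  induction L generalizing m n α with
  | nil => simp [optVal]
  | cons a L ih =>
    have hqL : ∀ b ∈ L, 0 < b.2 ∧ b.2 < 1 := fun b hb => hq b (by simp [hb])
    obtain ⟨hLa, hL'⟩ := List.pairwise_cons.1 hL
    obtain ⟨h0, h1⟩ := hq a (by simp)
    have hVa := hV' a (by simp)
    have hle : ∀ b ∈ L, adjEcpm b ≤ adjEcpm a := fun b hb => (hLa b hb).le
    have ih' : ∀ {m n : ℕ}, n ≤ m → _ := fun {m n} h =>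
      ih hqL hL' (fun b hb => hV' b (by simp [hb])) hle hVa (m := m) (n := n) h
    have key : (adjEcpm a - optVal (a :: L) m V') * (adjEcpm a - optVal (a :: L) (n + 1) V) ≤
        (adjEcpm a - optVal (a :: L) (m + 1) V') * (adjEcpm a - optVal (a :: L) n V) := by
      set f : ℕ → ℝ := fun i => adjEcpm a - optVal L i V
      set g : ℕ → ℝ := fun i => adjEcpm a - optVal L i V'
      have hfpos : ∀ i, 0 < f i := fun i =>
        sub_pos.2 (optVal_lt hqL hle (hVV.trans_lt hVa) i)
      have hgpos : ∀ i, 0 < g i := fun i => sub_pos.2 (optVal_lt hqL hle hVa i)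
      have step : ∀ (W : ℝ) (i : ℕ), adjEcpm a - optVal (a :: L) (i + 1) W =
          min (adjEcpm a - optVal L (i + 1) W) (a.2 * (adjEcpm a - optVal L i W)) := by
        intro W i
        rw [optVal, ← min_sub_sub_left]
        congr 1
        have := fst_eq_adjEcpm_mul h1
        linear_combination -this
      have zero : ∀ W : ℝ, adjEcpm a - optVal (a :: L) 0 W = adjEcpm a - optVal L 0 W := by
        intro W
        rw [optVal_zero, optVal_zero]
      have hQ : ∀ {m n : ℕ}, n ≤ m → g m * f (n + 1) ≤ g (m + 1) * f n := ih'
      set F : ℕ → ℝ := fun i => adjEcpm a - optVal (a :: L) i V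
      set G : ℕ → ℝ := fun i => adjEcpm a - optVal (a :: L) i V'
      have hF0 : F 0 = f 0 := zero V
      have hG0 : G 0 = g 0 := zero V'
      have hFs : ∀ i, F (i + 1) = min (f (i + 1)) (a.2 * f i) := step V
      have hGs : ∀ i, G (i + 1) = min (g (i + 1)) (a.2 * g i) := step V'
      change G m * F (n + 1) ≤ G (m + 1) * F n
      exact mul_succ_le_succ_mul_of_min h0 hfpos hgpos hQ hF0 hG0 hFs hGs hnm
    have hlast : ∀ (W : ℝ), W < adjEcpm a → ∀ i, 0 < adjEcpm a - optVal (a :: L) i W :=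
      fun W hW i => sub_pos.2 (optVal_lt hq (by simpa using hle) hW i)
    have hq' : ∀ b ∈ a :: L, 0 < b.2 := fun b hb => (hq b hb).1
    have hd := sub_le_sub_of_mul_le_mul (hlast V (hVV.trans_lt hVa) n)
      (by linarith [optVal_le_optVal_succ hq' n V])
      (by linarith [optVal_mono hq' hnm hVV]) key
    nlinarith [hα a (by simp)]

/-- The gain in optimal value from a better tail decreases with the number of slots. -/
lemma optVal_sub_optVal_antitone {L : List (ℝ × ℝ)} (hq : ∀ a ∈ L, 0 < a.2 ∧ a.2 < 1)
    (hL : L.Pairwise fun a b => adjEcpm b < adjEcpm a) {V V' : ℝ} (hVV : V ≤ V')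
    (hV' : ∀ a ∈ L, V' < adjEcpm a) :
    Antitone fun m => optVal L m V' - optVal L m V := by
  refine antitone_nat_of_succ_le fun m => ?_
  cases L with
  | nil => simp [optVal]
  | cons a L =>
    have hα : ∀ b ∈ a :: L, adjEcpm b ≤ adjEcpm a := by
      intro b hb
      rcases List.mem_cons.1 hb with rfl | hb
      · exact le_rfl
      · exact ((List.pairwise_cons.1 hL).1 b hb).le
    have hVa := hV' a (by simp)
    have hq' : ∀ b ∈ a :: L, 0 < b.2 := fun b hb => (hq b hb).1
    have := sub_le_sub_of_mul_le_mul (sub_pos.2 (optVal_lt hq hα (hVV.trans_lt hVa) m))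
      (by linarith [optVal_le_optVal_succ hq' m V])
      (by linarith [optVal_mono hq' (le_refl m) hVV])
      (sub_optVal_mul_le hq hL hVV hV' hα hVa (le_refl m))
    linarith

/-- Position monotonicity (Theorem 4, second part): fix a bidder `x` with
click-through rate `p` and continuation probability `qx`; its ad at bid `b` is
`(p·b, qx)`.  If at a common bid `b*` both `S = F ++ [x] ++ G` and
`T = A ++ [x] ++ E` are optimal assignments of `k` slots over the bidder set
`C ∪ {x}` (bidders with pairwise-distinct adjusted ecpms, `q ∈ (0,1)`), and `x` has a
strictly higher click probability in `T` (i.e. `q(A) > q(F)`), then `x`'s position in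
`T` is no lower than in `S`: `|A| ≤ |F|`.  Hence the position of `x` in the optimal
solution is monotone in its bid. -/
theorem position_monotonicity
    (C : Finset (ℝ × ℝ))
    (hC : ∀ a ∈ C, 0 < a.1 ∧ 0 < a.2 ∧ a.2 < 1)
    (p qx : ℝ) (hp : 0 < p) (hp1 : p ≤ 1) (hqx : 0 < qx) (hqx1 : qx < 1)
    (bstar : ℝ) (hb : 0 ≤ bstar)
    (x : ℝ × ℝ) (hx : x = (p * bstar, qx)) (hxC : x ∉ C)
    (hdistinct : ∀ a ∈ C, ∀ b ∈ C, a.1 / (1 - a.2) = b.1 / (1 - b.2) → a = b)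
    (hdistx : ∀ a ∈ C, a.1 / (1 - a.2) ≠ x.1 / (1 - x.2))
    (k : ℕ)
    (F G A E : List (ℝ × ℝ))
    (hSnd : (F ++ [x] ++ G).Nodup) (hSmem : ∀ a ∈ F ++ G, a ∈ C)
    (hSlen : (F ++ [x] ++ G).length = k)
    (hTnd : (A ++ [x] ++ E).Nodup) (hTmem : ∀ a ∈ A ++ E, a ∈ C)
    (hTlen : (A ++ [x] ++ E).length = k)
    (hSopt : ∀ T' : List (ℝ × ℝ), T'.Nodup → (∀ a ∈ T', a ∈ C ∨ a = x) →
      T'.length = k → eff T' ≤ eff (F ++ [x] ++ G))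
    (hTopt : ∀ T' : List (ℝ × ℝ), T'.Nodup → (∀ a ∈ T', a ∈ C ∨ a = x) →
      T'.length = k → eff T' ≤ eff (A ++ [x] ++ E))
    (hclick : qprod A > qprod F) :
    A.length ≤ F.length := by
  by_contra! hlen
  have hqC : ∀ a ∈ C, 0 < a.2 ∧ a.2 < 1 := fun a ha => (hC a ha).2
  have hx1 : 0 ≤ x.1 := by
    rw [hx]
    positivity
  have hx2 : 0 < x.2 ∧ x.2 < 1 := by
    rw [hx]
    exact ⟨hqx, hqx1⟩
  have hq : ∀ a, a ∈ C ∨ a = x → 0 < a.2 ∧ a.2 < 1 := by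
    rintro a (ha | rfl)
    exacts [hqC a ha, hx2]
  have hnonneg : ∀ a, a ∈ C ∨ a = x → 0 ≤ a.1 ∧ 0 < a.2 := by
    rintro a (ha | rfl)
    exacts [⟨(hC a ha).1.le, (hqC a ha).1⟩, ⟨hx1, hx2.1⟩]
  have hinj : ∀ a, a ∈ C ∨ a = x → ∀ b, b ∈ C ∨ b = x → adjEcpm a = adjEcpm b → a = b := by
    rintro a (ha | rfl) b (hb | rfl) hab
    exacts [hdistinct a ha b hb hab, absurd hab (hdistx a ha), absurd hab.symm (hdistx b hb), rfl]
  have hmem : ∀ {L M : List (ℝ × ℝ)}, (∀ a ∈ L ++ M, a ∈ C) →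
      ∀ a ∈ L ++ [x] ++ M, a ∈ C ∨ a = x := by
    intro L M h a ha
    simp only [List.mem_append, List.mem_singleton] at ha h
    rcases ha with (ha | ha) | ha
    exacts [.inl (h a (.inl ha)), .inr ha, .inl (h a (.inr ha))]
  have hsorted : ∀ {L M : List (ℝ × ℝ)}, (∀ a ∈ L ++ M, a ∈ C) → (L ++ [x] ++ M).Nodup →
      (L ++ [x] ++ M).length = k →
      (∀ T' : List (ℝ × ℝ), T'.Nodup → (∀ a ∈ T', a ∈ C ∨ a = x) →
        T'.length = k → eff T' ≤ eff (L ++ [x] ++ M)) →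
      L.Pairwise (fun a b => adjEcpm b < adjEcpm a) ∧ (∀ a ∈ L, adjEcpm x < adjEcpm a) ∧
        ∀ a ∈ M, adjEcpm a < adjEcpm x := by
    intro L M h hnd hl hopt
    have := pairwise_adjEcpm_of_optimal hnd (fun a ha => hq a (hmem h a ha))
      (fun a ha b hb => hinj a (hmem h a ha) b (hmem h b hb)) fun N hN =>
        hopt N (hN.nodup_iff.2 hnd) (fun a ha => hmem h a (hN.subset ha)) (hN.length_eq.trans hl)
    simp only [List.append_assoc, List.singleton_append, List.pairwise_append,
      List.pairwise_cons, List.mem_cons] at this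
    exact ⟨this.1, fun a ha => this.2.2 a ha x (.inl rfl), this.2.1.1⟩
  obtain ⟨hFs, hFx, hGx⟩ := hsorted hSmem hSnd hSlen hSopt
  obtain ⟨hAs, hAx, hEx⟩ := hsorted hTmem hTnd hTlen hTopt
  have hFC : ∀ a ∈ F, a ∈ C := fun a ha => hSmem a (by simp [ha])
  have hGC : ∀ a ∈ G, a ∈ C := fun a ha => hSmem a (by simp [ha])
  have hAC : ∀ a ∈ A, a ∈ C := fun a ha => hTmem a (by simp [ha])
  have hEC : ∀ a ∈ E, a ∈ C := fun a ha => hTmem a (by simp [ha])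
  have hEnd : E.Nodup := (List.nodup_append.1 hTnd).2.1
  have hGnd : G.Nodup := (List.nodup_append.1 hSnd).2.1
  have hlenEG : A.length + E.length = F.length + G.length := by
    simp only [List.length_append, List.length_singleton] at hSlen hTlen
    omega
  have hkC : k ≤ (insert x C).card := by
    rw [← hSlen, ← List.toFinset_card_of_nodup hSnd]
    refine Finset.card_le_card fun a ha => ?_
    have := hmem hSmem a (List.mem_toFinset.1 ha)
    rw [Finset.mem_insert]
    tauto
  have hshort : ∀ L : List (ℝ × ℝ), L.Nodup → (∀ a ∈ L, a ∈ C ∨ a = x) → L.length ≤ k →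
      eff L ≤ eff (F ++ [x] ++ G) ∧ eff L ≤ eff (A ++ [x] ++ E) := by
    intro L hL hLC hLk
    obtain ⟨M, hM, hMC, hMk⟩ := exists_nodup_append_length_eq (insert x C) hkC hL
      (fun a ha => Finset.mem_insert.2 (hLC a ha).symm) hLk
    have hMC' : ∀ a ∈ M, a ∈ C ∨ a = x := fun a ha => (Finset.mem_insert.1 (hMC a ha)).symm
    have hLM : ∀ a ∈ L ++ M, a ∈ C ∨ a = x := fun a ha =>
      (List.mem_append.1 ha).elim (hLC a) (hMC' a)
    have hle : eff L ≤ eff (L ++ M) := by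
      rw [eff_append]
      have := mul_nonneg (qprod_pos fun a ha => (hq a (hLC a ha)).1).le
        (eff_nonneg fun a ha => hnonneg a (hMC' a ha))
      linarith
    exact ⟨hle.trans (hSopt _ hM hLM hMk), hle.trans (hTopt _ hM hLM hMk)⟩
  have happ : ∀ L M : List (ℝ × ℝ), eff (L ++ [x] ++ M) =
      eff L + qprod L * (x.1 + x.2 * eff M) := by
    intro L M
    rw [List.append_assoc, eff_append]
    rfl
  have hnodup : ∀ {L M : List (ℝ × ℝ)}, L.Nodup → M.Nodup → (∀ a ∈ L, adjEcpm x < adjEcpm a) →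
      (∀ a ∈ M, adjEcpm a < adjEcpm x) → (L ++ [x] ++ M).Nodup := by
    intro L M hL hM hLx hMx
    rw [List.append_assoc, List.singleton_append]
    refine List.Nodup.append hL (List.nodup_cons.2 ⟨fun h => (hMx x h).false, hM⟩) ?_
    intro a ha haM
    rcases List.mem_cons.1 haM with rfl | haM
    · exact (hLx a ha).false
    · exact lt_asymm (hLx a ha) (hMx a haM)
  have hFnd : F.Nodup := hFs.imp fun h h' => by simp [h'] at h
  have hEG : eff E < eff G := by
    obtain ⟨c, hcG, hcE⟩ : ∃ c ∈ G, c ∉ E := by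
      by_contra! hsub
      have := (hGnd.subperm hsub).length_le
      omega
    have hnd : (F ++ [x] ++ (E ++ [c])).Nodup := by
      refine hnodup hFnd ?_ hFx ?_
      · refine hEnd.append (List.nodup_singleton c) ?_
        simpa using hcE
      · intro a ha
        rcases List.mem_append.1 ha with ha | ha
        · exact hEx a ha
        · rw [List.mem_singleton.1 ha]
          exact hGx c hcG
    have h := (hshort _ hnd (hmem (by
      intro a ha
      simp only [List.mem_append, List.mem_singleton] at ha
      rcases ha with ha | ha | rfl
      exacts [hFC a ha, hEC a ha, hGC a hcG])) (by
      simp only [List.length_append, List.length_singleton] at hSlen ⊢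
      omega)).1
    rw [happ, happ] at h
    have h := le_of_mul_le_mul_left (le_of_add_le_add_left h)
      (qprod_pos fun a ha => (hqC a (hFC a ha)).1)
    have h := le_of_mul_le_mul_left (le_of_add_le_add_left h) hx2.1
    refine lt_of_lt_of_le ?_ h
    rw [eff_append]
    have := mul_pos (qprod_pos fun a ha => (hqC a (hEC a ha)).1) (hC c (hGC c hcG)).1
    simpa [eff] using this
  have hxadj : 0 ≤ adjEcpm x := div_nonneg hx1 (by linarith [hx2.2])
  set V := x.1 + x.2 * eff E with hV
  set V' := x.1 + x.2 * eff G with hV'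
  have hVV : V < V' := by
    have := mul_lt_mul_of_pos_left hEG hx2.1
    linarith
  have hV'x : V' ≤ adjEcpm x := by
    have := eff_le_of_adjEcpm_le hxadj fun a ha => ⟨(hGx a ha).le, hqC a (hGC a ha)⟩
    rw [hV', fst_eq_adjEcpm_mul hx2.2]
    nlinarith [hx2.1]
  let r : ℝ × ℝ → ℝ × ℝ → Prop := fun a b => adjEcpm b ≤ adjEcpm a
  have : Std.Total r := ⟨fun a b => le_total _ _⟩
  have : IsTrans _ r := ⟨fun _ _ _ h h' => h'.trans h⟩
  have : DecidableRel r := Classical.decRel r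
  let H := (C.filter fun a => adjEcpm x < adjEcpm a).toList.insertionSort r
  have hHmem : ∀ a, a ∈ H ↔ a ∈ C ∧ adjEcpm x < adjEcpm a := by
    intro a
    simp [H]
  have hHnd : H.Nodup := (List.perm_insertionSort r _).nodup_iff.2 (Finset.nodup_toList _)
  have hHs : H.Pairwise fun a b => adjEcpm b < adjEcpm a := by
    refine ((List.pairwise_insertionSort r _).and hHnd).imp_of_mem fun {a b} ha hb h => ?_
    refine lt_of_le_of_ne h.1 fun h' => h.2 ?_
    exact hdistinct a ((hHmem a).1 ha).1 b ((hHmem b).1 hb).1 h'.symm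
  have hHq : ∀ a ∈ H, 0 < a.2 ∧ a.2 < 1 := fun a ha => hqC a ((hHmem a).1 ha).1
  have hHq' : ∀ a ∈ H, 0 < a.2 := fun a ha => (hHq a ha).1
  have hsub : ∀ {L : List (ℝ × ℝ)}, (∀ a ∈ L, a ∈ C) →
      L.Pairwise (fun a b => adjEcpm b < adjEcpm a) → (∀ a ∈ L, adjEcpm x < adjEcpm a) →
      L.Sublist H := by
    intro L hLC hLs hLx
    have : Std.Antisymm fun a b : ℝ × ℝ => adjEcpm b < adjEcpm a :=
      ⟨fun _ _ h h' => absurd h' h.asymm⟩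
    refine List.sublist_of_subperm_of_pairwise (List.Nodup.subperm ?_ ?_) hLs hHs
    · exact hLs.imp fun h h' => by simp [h'] at h
    · exact fun a ha => (hHmem a).2 ⟨hLC a ha, hLx a ha⟩
  have hXmem : ∀ {X : List (ℝ × ℝ)}, X.Sublist H →
      (∀ a ∈ X, a ∈ C) ∧ X.Nodup ∧ ∀ a ∈ X, adjEcpm x < adjEcpm a := fun hX =>
    ⟨fun a ha => ((hHmem a).1 (hX.subset ha)).1, hHnd.sublist hX,
      fun a ha => ((hHmem a).1 (hX.subset ha)).2⟩
  have hF := hsub hFC hFs hFx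
  have hA := hsub hAC hAs hAx
  have hoptA : optVal H A.length V ≤ eff A + qprod A * V := by
    obtain ⟨X, hX, hXl, h⟩ := exists_sublist_optVal_eq H A.length V
    obtain ⟨hXC, hXnd, hXx⟩ := hXmem hX
    rw [h, hV, ← happ, ← happ]
    refine (hshort _ (hnodup hXnd hEnd hXx hEx) (hmem fun a ha => ?_) ?_).2
    · exact (List.mem_append.1 ha).elim (hXC a) (hEC a)
    · simp only [List.length_append, List.length_singleton] at hTlen ⊢
      omega
  have hoptF : optVal H F.length V' ≤ eff F + qprod F * V' := by
    obtain ⟨X, hX, hXl, h⟩ := exists_sublist_optVal_eq H F.length V'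
    obtain ⟨hXC, hXnd, hXx⟩ := hXmem hX
    rw [h, hV', ← happ, ← happ]
    refine (hshort _ (hnodup hXnd hGnd hXx hGx) (hmem fun a ha => ?_) ?_).1
    · exact (List.mem_append.1 ha).elim (hXC a) (hGC a)
    · simp only [List.length_append, List.length_singleton] at hSlen ⊢
      omega
  have hgainA := le_optVal hA hHq' le_rfl V'
  have hgainF := le_optVal hF hHq' le_rfl V
  have hanti : optVal H A.length V' - optVal H A.length V ≤
      optVal H F.length V' - optVal H F.length V :=
    optVal_sub_optVal_antitone hHq hHs hVV.le
      (fun a ha => hV'x.trans_lt ((hHmem a).1 ha).2) hlen.le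
  nlinarith
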